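/- Suppose the full-space LFU problem is feasible. Let H* be the common Hessian of all minimizers of the full-space LFU problem and Ĥ* the common Hessian of all minimizers of the subspace LFU problem. Then Qᵀ H* Q = Ĥ*. Moreover, if H̄ = Q Qᵀ H̄ Q Qᵀ, then H* = Q Ĥ* Qᵀ. -/

import Mathlib

open Matrix

/-- Squared Frobenius norm of a real matrix. -/
noncomputable def frobSq {a b : ℕ} (A : Matrix (Fin a) (Fin b) ℝ) : ℝ :=
  ∑ i, ∑ j, (A i j) ^ 2

/-- Squared Euclidean norm of a real vector. -/
noncomputable def vecNormSq {a : ℕ} (v : Fin a → ℝ) : ℝ :=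
  ∑ i, (v i) ^ 2

/-- `v` lies in the orthogonal complement of the column space of `Q`. -/
def inColPerp {n d : ℕ} (Q : Matrix (Fin n) (Fin d) ℝ) (v : Fin n → ℝ) : Prop :=
  ∀ u : Fin d → ℝ, Q.mulVec u ⬝ᵥ v = 0

/-- Feasibility for the quadratic interpolation constraints: `p = (α, H)` with `H`
symmetric and `(dᵢ)ᵀ α + ½ (dᵢ)ᵀ H dᵢ = rhs i` for all `i`. -/
def QFeas {k m : ℕ} (dd : Fin m → Fin k → ℝ) (rhs : Fin m → ℝ)
    (p : (Fin k → ℝ) × Matrix (Fin k) (Fin k) ℝ) : Prop :=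
  p.2.IsSymm ∧ ∀ i, dd i ⬝ᵥ p.1 + (1 / 2) * (dd i ⬝ᵥ p.2.mulVec (dd i)) = rhs i

/-- Objective of the minimum norm (MN) problem. -/
noncomputable def MNObj {k : ℕ} (p : (Fin k → ℝ) × Matrix (Fin k) (Fin k) ℝ) : ℝ :=
  (1 / 2) * vecNormSq p.1 + (1 / 2) * frobSq p.2

/-- `p` is a minimizer of the MN problem. -/
def MNMin {k m : ℕ} (dd : Fin m → Fin k → ℝ) (rhs : Fin m → ℝ)
    (p : (Fin k → ℝ) × Matrix (Fin k) (Fin k) ℝ) : Prop :=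
  QFeas dd rhs p ∧ ∀ q, QFeas dd rhs q → MNObj p ≤ MNObj q

/-- Objective of the minimum Frobenius norm (MFN) problem. -/
noncomputable def MFNObj {k : ℕ} (p : (Fin k → ℝ) × Matrix (Fin k) (Fin k) ℝ) : ℝ :=
  (1 / 2) * frobSq p.2

/-- `p` is a minimizer of the MFN problem. -/
def MFNMin {k m : ℕ} (dd : Fin m → Fin k → ℝ) (rhs : Fin m → ℝ)
    (p : (Fin k → ℝ) × Matrix (Fin k) (Fin k) ℝ) : Prop :=
  QFeas dd rhs p ∧ ∀ q, QFeas dd rhs q → MFNObj p ≤ MFNObj q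

/-- Objective of the least Frobenius norm updating (LFU) problem. -/
noncomputable def LFUObj {k : ℕ} (Hbar : Matrix (Fin k) (Fin k) ℝ)
    (p : (Fin k → ℝ) × Matrix (Fin k) (Fin k) ℝ) : ℝ :=
  (1 / 2) * frobSq (p.2 - Hbar)

/-- `p` is a minimizer of the LFU problem with reference matrix `Hbar`. -/
def LFUMin {k m : ℕ} (dd : Fin m → Fin k → ℝ) (rhs : Fin m → ℝ)
    (Hbar : Matrix (Fin k) (Fin k) ℝ)
    (p : (Fin k → ℝ) × Matrix (Fin k) (Fin k) ℝ) : Prop :=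
  QFeas dd rhs p ∧ ∀ q, QFeas dd rhs q → LFUObj Hbar p ≤ LFUObj Hbar q

/-- `X` is a Moore–Penrose pseudoinverse of `A`. -/
def IsMPInv {a b : ℕ} (A : Matrix (Fin a) (Fin b) ℝ) (X : Matrix (Fin b) (Fin a) ℝ) : Prop :=
  A * X * A = A ∧ X * A * X = X ∧ (A * X)ᵀ = A * X ∧ (X * A)ᵀ = X * A

/-- The vector `δ_g(y⁰; W)` with `i`-th entry `g(y⁰ + wⁱ) − g(y⁰)`,
where `wⁱ` is the `i`-th column of `W`. -/
noncomputable def deltaVec {k p : ℕ} (g : (Fin k → ℝ) → ℝ) (y0 : Fin k → ℝ)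
    (W : Matrix (Fin k) (Fin p) ℝ) : Fin p → ℝ :=
  fun i => g (y0 + fun j => W j i) - g y0

theorem frobSq_eq_trace {a b : ℕ} (A : Matrix (Fin a) (Fin b) ℝ) :
    frobSq A = (Aᵀ * A).trace := by
  simp only [frobSq, Matrix.trace, Matrix.diag, Matrix.mul_apply, Matrix.transpose_apply, sq]
  exact Finset.sum_comm

theorem frobSq_nonneg {a b : ℕ} (A : Matrix (Fin a) (Fin b) ℝ) : 0 ≤ frobSq A :=
  Finset.sum_nonneg fun _ _ => Finset.sum_nonneg fun _ _ => sq_nonneg _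

theorem frobSq_transpose {a b : ℕ} (A : Matrix (Fin a) (Fin b) ℝ) : frobSq Aᵀ = frobSq A :=
  Finset.sum_comm

/-- Left multiplication by a matrix with orthonormal columns preserves the Frobenius norm. -/
theorem frobSq_mul_left {n d k : ℕ} {Q : Matrix (Fin n) (Fin d) ℝ} (hQ : Qᵀ * Q = 1)
    (M : Matrix (Fin d) (Fin k) ℝ) : frobSq (Q * M) = frobSq M := by
  rw [frobSq_eq_trace, frobSq_eq_trace, transpose_mul, Matrix.mul_assoc, ← Matrix.mul_assoc Qᵀ,
    hQ, Matrix.one_mul]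

theorem frobSq_conj {n d : ℕ} {Q : Matrix (Fin n) (Fin d) ℝ} (hQ : Qᵀ * Q = 1)
    (M : Matrix (Fin d) (Fin d) ℝ) : frobSq (Q * M * Qᵀ) = frobSq M := by
  rw [← frobSq_transpose, transpose_mul, transpose_transpose, frobSq_mul_left hQ,
    frobSq_transpose, frobSq_mul_left hQ]

theorem frobSq_transpose_mul_le {n d k : ℕ} {Q : Matrix (Fin n) (Fin d) ℝ} (hQ : Qᵀ * Q = 1)
    (A : Matrix (Fin n) (Fin k) ℝ) : frobSq (Qᵀ * A) ≤ frobSq A := by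
  have h : frobSq A - frobSq (Qᵀ * A) = frobSq (A - Q * (Qᵀ * A)) := by
    have hQ' : Qᵀ * (Q * (Qᵀ * A)) = Qᵀ * A := by
      rw [← Matrix.mul_assoc, hQ, Matrix.one_mul]
    simp only [frobSq_eq_trace, transpose_sub, transpose_mul, transpose_transpose,
      Matrix.sub_mul, Matrix.mul_sub, Matrix.mul_assoc, trace_sub, hQ']
    ring
  linarith [frobSq_nonneg (A - Q * (Qᵀ * A))]

/-- Compression to a subspace does not increase the Frobenius norm. -/
theorem frobSq_compress_le {n d : ℕ} {Q : Matrix (Fin n) (Fin d) ℝ} (hQ : Qᵀ * Q = 1)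
    (A : Matrix (Fin n) (Fin n) ℝ) : frobSq (Qᵀ * A * Q) ≤ frobSq A := by
  rw [← frobSq_transpose, transpose_mul]
  refine (frobSq_transpose_mul_le hQ _).trans ?_
  rw [frobSq_transpose]
  exact frobSq_transpose_mul_le hQ A

theorem mulVec_dotProduct_eq {n d : ℕ} (Q : Matrix (Fin n) (Fin d) ℝ) (u : Fin d → ℝ)
    (v : Fin n → ℝ) : Q.mulVec u ⬝ᵥ v = u ⬝ᵥ Qᵀ.mulVec v := by
  rw [dotProduct_comm, dotProduct_mulVec, dotProduct_comm, mulVec_transpose]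

/-- A quadratic model interpolates along `Q dᵢ` iff its compression interpolates along `dᵢ`. -/
theorem qFeas_mulVec_iff {n d m : ℕ} (Q : Matrix (Fin n) (Fin d) ℝ) (dh : Fin m → Fin d → ℝ)
    (rhs : Fin m → ℝ) (α : Fin n → ℝ) {H : Matrix (Fin n) (Fin n) ℝ} (hH : H.IsSymm) :
    QFeas (fun i => Q.mulVec (dh i)) rhs (α, H) ↔
      QFeas dh rhs (Qᵀ.mulVec α, Qᵀ * H * Q) := by
  have hH' : (Qᵀ * H * Q).IsSymm := by
    simp only [IsSymm, transpose_mul, transpose_transpose, hH.eq, Matrix.mul_assoc]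
  simp only [QFeas, hH, hH', true_and]
  simp only [mulVec_dotProduct_eq, mulVec_mulVec, Matrix.mul_assoc]

/-- If the full-space LFU problem is feasible, `H*` is the common
Hessian of its minimizers, and `Ĥ*` is the common Hessian of the subspace LFU
minimizers, then `Qᵀ H* Q = Ĥ*`; moreover, if `H̄ = Q Qᵀ H̄ Q Qᵀ`, then
`H* = Q Ĥ* Qᵀ`. -/
theorem stmt_9 {n d m : ℕ} (hn : 0 < n) (hd : 0 < d) (hm : 0 < m) (hdn : d < n)
    (Q : Matrix (Fin n) (Fin d) ℝ) (hQ : Qᵀ * Q = 1)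
    (f : (Fin n → ℝ) → ℝ) (x0 : Fin n → ℝ) (dh : Fin m → Fin d → ℝ)
    (fh : (Fin d → ℝ) → ℝ) (hfh : ∀ xh, fh xh = f (x0 + Q.mulVec xh))
    (Hbar : Matrix (Fin n) (Fin n) ℝ) (hHbar : Hbar.IsSymm)
    (hfeas : ∃ p, QFeas (fun i => Q.mulVec (dh i))
      (fun i => f (x0 + Q.mulVec (dh i)) - f x0) p)
    (Hs : Matrix (Fin n) (Fin n) ℝ)
    (hHsMin : ∃ α, LFUMin (fun i => Q.mulVec (dh i))
      (fun i => f (x0 + Q.mulVec (dh i)) - f x0) Hbar (α, Hs))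
    (hHsAll : ∀ p, LFUMin (fun i => Q.mulVec (dh i))
      (fun i => f (x0 + Q.mulVec (dh i)) - f x0) Hbar p → p.2 = Hs)
    (Hhs : Matrix (Fin d) (Fin d) ℝ)
    (hHhsMin : ∃ αh, LFUMin dh (fun i => fh (dh i) - fh 0) (Qᵀ * Hbar * Q) (αh, Hhs))
    (hHhsAll : ∀ p, LFUMin dh (fun i => fh (dh i) - fh 0) (Qᵀ * Hbar * Q) p → p.2 = Hhs) :
    Qᵀ * Hs * Q = Hhs ∧
    (Hbar = Q * Qᵀ * Hbar * Q * Qᵀ → Hs = Q * Hhs * Qᵀ) := by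
  obtain ⟨αh, hsub, hsubMin⟩ := hHhsMin
  have hrhs : (fun i => fh (dh i) - fh 0) = fun i => f (x0 + Q.mulVec (dh i)) - f x0 := by
    funext i
    simp [hfh]
  rw [hrhs] at hsub hsubMin
  set H' := Hbar + Q * (Hhs - Qᵀ * Hbar * Q) * Qᵀ with hH'
  have hcancel (M : Matrix (Fin d) (Fin d) ℝ) : Qᵀ * (Q * M * Qᵀ) * Q = M := by
    rw [Matrix.mul_assoc, Matrix.mul_assoc (Q * M), hQ, Matrix.mul_one, ← Matrix.mul_assoc, hQ,
      Matrix.one_mul]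
  have hcomp : Qᵀ * H' * Q = Hhs := by
    rw [hH', Matrix.mul_add, Matrix.add_mul, hcancel, add_sub_cancel]
  have hsymm : H'.IsSymm := by
    have hs : Hhsᵀ = Hhs := hsub.1
    simp only [hH', IsSymm, transpose_add, transpose_mul, transpose_sub, transpose_transpose,
      hHbar.eq, hs, Matrix.mul_assoc]
  have hmin : LFUMin (fun i => Q.mulVec (dh i))
      (fun i => f (x0 + Q.mulVec (dh i)) - f x0) Hbar (Q.mulVec αh, H') := by
    refine ⟨?_, fun q hq => ?_⟩
    · rw [qFeas_mulVec_iff Q dh _ _ hsymm, hcomp, mulVec_mulVec, hQ, one_mulVec]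
      exact hsub
    · have h := hsubMin (Qᵀ.mulVec q.1, Qᵀ * q.2 * Q) ((qFeas_mulVec_iff Q dh _ q.1 hq.1).1 hq)
      have hle := frobSq_compress_le hQ (q.2 - Hbar)
      simp only [LFUObj, ← Matrix.mul_sub, ← Matrix.sub_mul] at h ⊢
      rw [hH', add_sub_cancel_left, frobSq_conj hQ]
      linarith
  have hHs : H' = Hs := hHsAll _ hmin
  refine ⟨hHs ▸ hcomp, fun hbar => ?_⟩
  have hproj : Q * (Qᵀ * Hbar * Q) * Qᵀ = Hbar := by
    simpa only [Matrix.mul_assoc] using hbar.symm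
  rw [← hHs, hH', Matrix.mul_sub, Matrix.sub_mul, hproj, add_sub_cancel]
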